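/- The map q ↦ γ_v(q) is continuous on [0,1]; γ_v(1) = γ_w(1); γ_v(0) = sup_{s ≥ 0}(s − Ψ_1^0(s)), which is the busy-period decay rate of the queue with service time B′; and γ_v attains every value between γ_v(0) and γ_v(1). -/

import Mathlib

open MeasureTheory ProbabilityTheory Filter
open scoped ENNReal

/-- The (extended-real-valued) moment generating function `Φ_X(s) = E[e^{sX}]`. -/
noncomputable def emgf {Ω : Type*} [MeasurableSpace Ω] (μ : Measure Ω) (X : Ω → ℝ) (s : ℝ) :
    ℝ≥0∞ :=
  ∫⁻ ω, ENNReal.ofReal (Real.exp (s * X ω)) ∂μ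

lemma emgf_eq_ofReal_mgf {Ω : Type*} [MeasurableSpace Ω] {μ : Measure Ω} {X : Ω → ℝ} {s : ℝ}
    (h : Integrable (fun ω => Real.exp (s * X ω)) μ) :
    emgf μ X s = ENNReal.ofReal (mgf X μ s) :=
  (ofReal_integral_eq_lintegral_ofReal h (ae_of_all _ fun _ => (Real.exp_pos _).le)).symm

/-- An integrable function dominates strictly in mean if it dominates a.e. and strictly so on a
set of positive measure. -/
lemma integral_lt_integral_of_ae_le_of_pos {Ω : Type*} [MeasurableSpace Ω] {μ : Measure Ω}
    {f g : Ω → ℝ} (hf : Integrable f μ) (hg : Integrable g μ) (hle : ∀ᵐ ω ∂μ, f ω ≤ g ω)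
    (hlt : 0 < μ {ω | f ω < g ω}) : ∫ ω, f ω ∂μ < ∫ ω, g ω ∂μ := by
  rw [← sub_pos, ← integral_sub' hg hf, integral_pos_iff_support_of_nonneg_ae _ (hg.sub hf)]
  · exact hlt.trans_le (measure_mono fun ω hω => (sub_pos.2 hω).ne')
  · filter_upwards [hle] with ω hω using sub_nonneg.2 hω

lemma mgf_lt_secant {Ω : Type*} [MeasurableSpace Ω] {μ : Measure Ω} [IsProbabilityMeasure μ]
    {X : Ω → ℝ} (hX : ∀ s, 0 ≤ s → Integrable (fun ω => Real.exp (s * X ω)) μ)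
    (hpos : 0 < μ {ω | 0 < X ω}) {s t : ℝ} (hs : 0 < s) (hst : s < t) :
    mgf X μ s < (1 - s / t) + s / t * mgf X μ t := by
  have ht : 0 < t := hs.trans hst
  have h0 : 0 < s / t := div_pos hs ht
  have h1 : 0 < 1 - s / t := sub_pos.2 ((div_lt_one ht).2 hst)
  have hst' : ∀ x, (1 - s / t) * 0 + s / t * (t * x) = s * x := fun x => by field_simp; ring
  have key : ∫ ω, ((1 - s / t) + s / t * Real.exp (t * X ω)) ∂μ
      = (1 - s / t) + s / t * mgf X μ t := by
    rw [integral_add (integrable_const _) ((hX t ht.le).const_mul _), integral_const_mul]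
    simp [mgf]
  rw [← key]
  refine integral_lt_integral_of_ae_le_of_pos (hX s hs.le)
    ((integrable_const _).add ((hX t ht.le).const_mul _)) (ae_of_all _ fun ω => ?_)
    (hpos.trans_le (measure_mono fun ω hω => ?_))
  · have := convexOn_exp.2 (Set.mem_univ 0) (Set.mem_univ (t * X ω)) h1.le h0.le (by ring)
    simpa only [smul_eq_mul, hst', Real.exp_zero, mul_one] using this
  · have hne : (0 : ℝ) ≠ t * X ω := (mul_pos ht hω).ne
    have := strictConvexOn_exp.2 (Set.mem_univ 0) (Set.mem_univ (t * X ω)) hne h1 h0 (by ring)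
    simpa only [Set.mem_ofPred_eq, smul_eq_mul, hst', Real.exp_zero, mul_one] using this

lemma exists_linear_le_mgf {Ω : Type*} [MeasurableSpace Ω] {μ : Measure Ω}
    [IsProbabilityMeasure μ] {X : Ω → ℝ} {b : ℝ} (hm : Measurable X) (hb : ∀ᵐ ω ∂μ, X ω ≤ b)
    (hpos : 0 < μ {ω | 0 < X ω}) : ∃ δ, 0 < δ ∧ ∀ s, 0 ≤ s → δ * s ≤ mgf X μ s := by
  have hint : Integrable (fun ω => max (X ω) 0) μ := by
    refine .of_mem_Icc 0 (max b 0) (hm.max measurable_const).aemeasurable ?_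
    filter_upwards [hb] with ω hω using ⟨le_max_right _ _, max_le_max_right _ hω⟩
  refine ⟨∫ ω, max (X ω) 0 ∂μ, ?_, fun s hs => ?_⟩
  · refine (integral_pos_iff_support_of_nonneg_ae
      (ae_of_all _ fun ω => le_max_right (X ω) 0) hint).2 ?_
    exact hpos.trans_le (measure_mono fun ω hω => (lt_max_of_lt_left hω).ne')
  · rw [← integral_mul_const]
    refine integral_mono (hint.mul_const s)
      (integrable_exp_mul_of_le s b hs hm.aemeasurable hb) fun ω => ?_
    dsimp only
    rcases le_total (X ω) 0 with h | h
    · rw [max_eq_right h, zero_mul]; positivity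
    · rw [max_eq_left h]
      linarith [Real.add_one_le_exp (s * X ω), mul_comm s (X ω)]

lemma mgf_neg_strictAntiOn {Ω : Type*} [MeasurableSpace Ω] {μ : Measure Ω}
    [IsProbabilityMeasure μ] {X : Ω → ℝ} (hm : Measurable X) (hX : ∀ᵐ ω ∂μ, 0 < X ω) :
    StrictAntiOn (fun u => mgf X μ (-u)) (Set.Ici 0) := by
  have hint : ∀ u, 0 ≤ u → Integrable (fun ω => Real.exp (-u * X ω)) μ := fun u hu => by
    have := integrable_exp_mul_of_le (μ := μ) (X := fun ω => -X ω) u 0 hu hm.neg.aemeasurable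
      (by filter_upwards [hX] with ω hω using by linarith)
    simpa using this
  intro u hu v hv huv
  have hlt : ∀ᵐ ω ∂μ, Real.exp (-v * X ω) < Real.exp (-u * X ω) := by
    filter_upwards [hX] with ω hω
    exact Real.exp_lt_exp.2 (mul_lt_mul_of_pos_right (neg_lt_neg huv) hω)
  refine integral_lt_integral_of_ae_le_of_pos (hint v hv) (hint u hu) (hlt.mono fun _ h => h.le) ?_
  rw [pos_iff_ne_zero]
  intro h0
  have : ∀ᵐ _ ∂μ, False := by
    filter_upwards [hlt, measure_eq_zero_iff_ae_notMem.1 h0] with ω h1 h2 using h2 h1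
  exact IsProbabilityMeasure.ne_zero μ (by simpa using this)

/-- A family of curves `f q`, `q ∈ [0, 1]`, started at one, continuous in `q`, lying strictly below
their secants from the origin and growing at least linearly, uniformly in `q`. -/
structure IsSecantFamily (f : ℝ → ℝ → ℝ) : Prop where
  zero : ∀ q ∈ Set.Icc (0 : ℝ) 1, f q 0 = 1
  cont : ∀ s, Continuous fun q => f q s
  secant : ∀ q ∈ Set.Icc (0 : ℝ) 1, ∀ s t, 0 < s → s < t → f q s < (1 - s / t) + s / t * f q t
  growth : ∃ δ, 0 < δ ∧ ∀ q ∈ Set.Icc (0 : ℝ) 1, ∀ s, 0 ≤ s → δ * s ≤ f q s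

namespace IsSecantFamily

variable {f : ℝ → ℝ → ℝ} {γ : ℝ → ℝ}

lemma lt_one (hf : IsSecantFamily f) {q s t : ℝ} (hq : q ∈ Set.Icc (0 : ℝ) 1) (hs : 0 < s)
    (hst : s < t) (ht : f q t ≤ 1) : f q s < 1 := by
  have h := hf.secant q hq s t hs hst
  have : 0 < s / t := div_pos hs (hs.trans hst)
  nlinarith

lemma nonempty (hf : IsSecantFamily f) {q : ℝ} (hq : q ∈ Set.Icc (0 : ℝ) 1) :
    {s : ℝ | 0 ≤ s ∧ f q s ≤ 1}.Nonempty :=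
  ⟨0, le_rfl, (hf.zero q hq).le⟩

lemma bddAbove (hf : IsSecantFamily f) {q : ℝ} (hq : q ∈ Set.Icc (0 : ℝ) 1) :
    BddAbove {s : ℝ | 0 ≤ s ∧ f q s ≤ 1} := by
  obtain ⟨δ, hδ, h⟩ := hf.growth
  refine ⟨1 / δ, fun s hs => ?_⟩
  rw [le_div_iff₀ hδ, mul_comm]
  exact (h q hq s hs.1).trans hs.2

lemma root_nonneg (hf : IsSecantFamily f) {q : ℝ} (hq : q ∈ Set.Icc (0 : ℝ) 1) :
    0 ≤ sSup {s : ℝ | 0 ≤ s ∧ f q s ≤ 1} :=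
  le_csSup (hf.bddAbove hq) ⟨le_rfl, (hf.zero q hq).le⟩

lemma one_lt (hf : IsSecantFamily f) {q s : ℝ} (hq : q ∈ Set.Icc (0 : ℝ) 1)
    (hs : sSup {s : ℝ | 0 ≤ s ∧ f q s ≤ 1} < s) : 1 < f q s := by
  by_contra! h
  exact hs.not_ge (le_csSup (hf.bddAbove hq) ⟨(hf.root_nonneg hq).trans hs.le, h⟩)

lemma continuousOn_root (hf : IsSecantFamily f)
    (hγ : ∀ q ∈ Set.Icc (0 : ℝ) 1, γ q = sSup {s : ℝ | 0 ≤ s ∧ f q s ≤ 1}) :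
    ContinuousOn γ (Set.Icc 0 1) := by
  intro p hp
  refine tendsto_order.2 ⟨fun x hx => ?_, fun x hx => ?_⟩
  · rcases lt_or_ge x 0 with h0 | h0
    · filter_upwards [self_mem_nhdsWithin] with q hq
      rw [hγ q hq]
      exact h0.trans_le (hf.root_nonneg hq)
    · obtain ⟨y, hxy, hy⟩ := exists_between hx
      rw [hγ p hp] at hy
      obtain ⟨t, ht, hyt⟩ := exists_lt_of_lt_csSup (hf.nonempty hp) hy
      have hy0 : 0 < y := h0.trans_lt hxy
      filter_upwards [self_mem_nhdsWithin, nhdsWithin_le_nhds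
        ((hf.cont y).continuousAt.eventually_lt_const (hf.lt_one hp hy0 hyt ht.2))] with q hq h
      rw [hγ q hq]
      exact hxy.trans_le (le_csSup (hf.bddAbove hq) ⟨hy0.le, h.le⟩)
  · obtain ⟨y, hy, hyx⟩ := exists_between hx
    rw [hγ p hp] at hy
    have hy0 : 0 < y := (hf.root_nonneg hp).trans_lt hy
    filter_upwards [self_mem_nhdsWithin, nhdsWithin_le_nhds
      ((hf.cont y).continuousAt.eventually_const_lt (hf.one_lt hp hy))] with q hq h
    rw [hγ q hq]
    refine (csSup_le (hf.nonempty hq) fun t ht => ?_).trans_lt hyx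
    by_contra! hyt
    exact h.not_gt (hf.lt_one hq hy0 hyt ht.2)

end IsSecantFamily

/-- The solution `Ψ` of `a (Ψ x) * g x = 1`, with `a` strictly decreasing and `g` positive and
continuous, is continuous. -/
lemma continuousOn_of_strictAntiOn_mul_eq_one {E : Type*} [TopologicalSpace E] {D : Set E}
    {a : ℝ → ℝ} {g Ψ : E → ℝ} (ha : StrictAntiOn a (Set.Ici 0)) (hg : ContinuousOn g D)
    (hgpos : ∀ x ∈ D, 0 < g x) (hΨ : ∀ x ∈ D, 0 ≤ Ψ x) (h : ∀ x ∈ D, a (Ψ x) * g x = 1) :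
    ContinuousOn Ψ D := by
  intro p hp
  refine tendsto_order.2 ⟨fun y hy => ?_, fun y hy => ?_⟩
  · rcases lt_or_ge y 0 with h0 | h0
    · filter_upwards [self_mem_nhdsWithin] with x hx using h0.trans_le (hΨ x hx)
    · have h1 : 1 < a y * g p := by
        rw [← h p hp]
        exact mul_lt_mul_of_pos_right (ha h0 (hΨ p hp) hy) (hgpos p hp)
      filter_upwards [self_mem_nhdsWithin,
        ((hg p hp).const_mul (a y)).eventually_const_lt h1] with x hx hx1
      rw [← h x hx] at hx1
      exact (ha.lt_iff_gt (hΨ x hx) h0).1 (lt_of_mul_lt_mul_right hx1 (hgpos x hx).le)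
  · have h0 : 0 ≤ y := (hΨ p hp).trans hy.le
    have h1 : a y * g p < 1 := by
      rw [← h p hp]
      exact mul_lt_mul_of_pos_right (ha (hΨ p hp) h0 hy) (hgpos p hp)
    filter_upwards [self_mem_nhdsWithin,
      ((hg p hp).const_mul (a y)).eventually_lt_const h1] with x hx hx1
    rw [← h x hx] at hx1
    exact (ha.lt_iff_gt h0 (hΨ x hx)).1 (lt_of_mul_lt_mul_right hx1 (hgpos x hx).le)

/-- The maximum of a continuous function over the segments `[0, γ q]` depends continuously on
`q` when `γ` does. -/
lemma continuousOn_sSup_segment {h : ℝ → ℝ → ℝ} {γ : ℝ → ℝ} {S : Set ℝ}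
    (hh : ContinuousOn (fun p : ℝ × ℝ => h p.1 p.2) (S ×ˢ Set.Ici 0))
    (hγ : ContinuousOn γ S) (hγ0 : ∀ q ∈ S, 0 ≤ γ q) :
    ContinuousOn (fun q => sSup {x : ℝ | ∃ s, 0 ≤ s ∧ s ≤ γ q ∧ x = h q s}) S := by
  rw [continuousOn_iff_continuous_domRestrict] at hγ ⊢
  have hcont : Continuous
      ↿(fun (q : S) (t : Set.Icc (0 : ℝ) 1) => h q (t * γ q)) := by
    refine hh.comp_continuous (f := fun p : S × Set.Icc (0 : ℝ) 1 =>
      ((p.1 : ℝ), (p.2 : ℝ) * γ p.1)) ?_ fun p => ⟨p.1.2, mul_nonneg p.2.2.1 (hγ0 _ p.1.2)⟩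
    exact (continuous_subtype_val.comp continuous_fst).prodMk
      ((continuous_subtype_val.comp continuous_snd).mul (hγ.comp continuous_fst))
  convert isCompact_univ.continuous_sSup hcont using 2 with q
  simp only [Set.domRestrict_apply]
  congr 1
  ext x
  simp only [Set.image_univ, Set.mem_range, Set.mem_ofPred_eq]
  constructor
  · rintro ⟨s, hs, hsγ, rfl⟩
    rcases (hγ0 q q.2).eq_or_lt with h0 | h0
    · refine ⟨⟨0, by simp⟩, ?_⟩
      rw [zero_mul, le_antisymm (hsγ.trans h0.ge) hs]
    · refine ⟨⟨s / γ q, div_nonneg hs h0.le, (div_le_one h0).2 hsγ⟩, ?_⟩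
      simp only [div_mul_cancel₀ _ h0.ne']
  · rintro ⟨t, rfl⟩
    exact ⟨t * γ q, mul_nonneg t.2.1 (hγ0 q q.2), mul_le_of_le_one_left (hγ0 q q.2) t.2.2, rfl⟩

/-- For the family of service-time laws `B(q) = (1-q)·law(B') + q·δ_c`
(mass `q` at the right endpoint `c`), the SRPT sojourn-time decay rate `q ↦ γ_v(q)` is
continuous on `[0,1]`; `γ_v(1) = γ_w(1)`; `γ_v(0) = sup_{s ≥ 0} (s - Ψ_1^0(s))` (the
busy-period decay rate of the queue with service time `B'`); and `γ_v` attains every value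
between `γ_v(0)` and `γ_v(1)`. -/
theorem srpt_decay_rate_continuous_in_mass_at_endpoint
    {Ω : Type*} [MeasurableSpace Ω] (μ : Measure Ω) [IsProbabilityMeasure μ]
    (A B' : Ω → ℝ) (c : ℝ)
    (hAmeas : Measurable A) (hB'meas : Measurable B')
    (hindep : IndepFun A B' μ)
    (hApos : ∀ᵐ ω ∂μ, 0 < A ω)
    (hAint : Integrable A μ)
    (hc : 0 < c) (hcEA : c < ∫ ω, A ω ∂μ)
    (hAc : 0 < μ {ω | A ω < c})
    (hB'nonneg : ∀ᵐ ω ∂μ, 0 ≤ B' ω)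
    (hB'lt : ∀ᵐ ω ∂μ, B' ω < c)
    (hB'pos : 0 < μ {ω | 0 < B' ω})
    (hB'A : 0 < μ {ω | A ω < B' ω})
    -- the workload decay rate of the queue with service-time law
    -- `B(q) = (1-q)·law(B') + q·δ_c`, i.e. `Φ_{B(q)}(s) = (1-q) Φ_{B'}(s) + q e^{cs}`
    (γw : ℝ → ℝ)
    (hγw : ∀ q, γw q = sSup {s : ℝ | 0 ≤ s ∧
      emgf μ A (-s) *
        (ENNReal.ofReal (1 - q) * emgf μ B' s + ENNReal.ofReal q * ENNReal.ofReal (Real.exp (c * s)))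
      ≤ 1})
    -- `Ψ_1^q(s)` is the unique `u ≥ 0` with `Φ_A(-u) ((1-q) Φ_{B'}(s) + q) = 1`
    (Ψ1 : ℝ → ℝ → ℝ)
    (hΨ1 : ∀ q, 0 ≤ q → q ≤ 1 → ∀ s, 0 ≤ s →
      0 ≤ Ψ1 q s ∧
        emgf μ A (-(Ψ1 q s)) * (ENNReal.ofReal (1 - q) * emgf μ B' s + ENNReal.ofReal q) = 1)
    -- `γ_v(q)` is the SRPT sojourn-time decay rate of the queue with service law `B(q)`
    (γv : ℝ → ℝ)
    (hγv : ∀ q, γv q = sSup {x : ℝ | ∃ s, 0 ≤ s ∧ s ≤ γw q ∧ x = s - Ψ1 q s}) :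
    ContinuousOn γv (Set.Icc 0 1) ∧
    γv 1 = γw 1 ∧
    γv 0 = sSup {x : ℝ | ∃ s, 0 ≤ s ∧ x = s - Ψ1 0 s} ∧
    (∀ x, x ∈ Set.Icc (γv 0) (γv 1) → ∃ q ∈ Set.Icc (0:ℝ) 1, γv q = x) := by
  have hAexp : ∀ u, 0 ≤ u → Integrable (fun ω => Real.exp (-u * A ω)) μ := fun u hu => by
    have := integrable_exp_mul_of_le (μ := μ) (X := fun ω => -A ω) u 0 hu hAmeas.neg.aemeasurable
      (by filter_upwards [hApos] with ω hω using by linarith)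
    simpa using this
  have hBexp : ∀ s, Integrable (fun ω => Real.exp (s * B' ω)) μ := fun s =>
    integrable_exp_mul_of_mem_Icc (a := 0) (b := c) hB'meas.aemeasurable
      (by filter_upwards [hB'nonneg, hB'lt] with ω h0 h1 using ⟨h0, h1.le⟩)
  have ha : StrictAntiOn (fun u => mgf A μ (-u)) (Set.Ici 0) := mgf_neg_strictAntiOn hAmeas hApos
  -- the increments of the two extreme queues
  have hX₀le : ∀ᵐ ω ∂μ, (B' + -A) ω ≤ c := by
    filter_upwards [hApos, hB'lt] with ω h0 h1
    simp only [Pi.add_apply, Pi.neg_apply]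
    linarith
  have hX₁le : ∀ᵐ ω ∂μ, c + (-A) ω ≤ c := by
    filter_upwards [hApos] with ω h0
    simp only [Pi.neg_apply]
    linarith
  have hX₀m : Measurable (B' + -A) := hB'meas.add hAmeas.neg
  have hX₁m : Measurable fun ω => c + (-A) ω := hAmeas.neg.const_add c
  have hX₀pos : 0 < μ {ω | 0 < (B' + -A) ω} :=
    hB'A.trans_le (measure_mono fun ω (hω : A ω < B' ω) => by simpa [← sub_eq_add_neg] using hω)
  have hX₁pos : 0 < μ {ω | 0 < c + (-A) ω} :=
    hAc.trans_le (measure_mono fun ω (hω : A ω < c) => by simpa [← sub_eq_add_neg] using hω)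
  have hmgf₀ : ∀ s, mgf (B' + -A) μ s = mgf A μ (-s) * mgf B' μ s := fun s => by
    have hind : IndepFun B' (-A) μ := hindep.symm.comp measurable_id measurable_neg
    rw [hind.mgf_add' hB'meas.aestronglyMeasurable hAmeas.neg.aestronglyMeasurable, mgf_neg,
      mul_comm]
  have hmgf₁ : ∀ s, mgf (fun ω => c + (-A) ω) μ s = mgf A μ (-s) * Real.exp (c * s) := fun s => by
    rw [mgf_const_add, mgf_neg, mul_comm, mul_comm s]
  have hfam : IsSecantFamily fun q s =>
      (1 - q) * mgf (B' + -A) μ s + q * mgf (fun ω => c + (-A) ω) μ s := by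
    refine ⟨fun q _ => by simp, fun s => by fun_prop, fun q hq s t hs hst => ?_, ?_⟩
    · have h₀ := mgf_lt_secant (fun s hs =>
        integrable_exp_mul_of_le s c hs hX₀m.aemeasurable hX₀le) hX₀pos hs hst
      have h₁ := mgf_lt_secant (fun s hs =>
        integrable_exp_mul_of_le s c hs hX₁m.aemeasurable hX₁le) hX₁pos hs hst
      rcases hq.1.eq_or_lt with rfl | h
      · simpa using h₀
      · have := mul_lt_mul_of_pos_left h₁ h
        have := mul_le_mul_of_nonneg_left h₀.le (sub_nonneg.2 hq.2)
        linarith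
    · obtain ⟨δ₀, hδ₀, h₀⟩ := exists_linear_le_mgf hX₀m hX₀le hX₀pos
      obtain ⟨δ₁, hδ₁, h₁⟩ := exists_linear_le_mgf hX₁m hX₁le hX₁pos
      refine ⟨min δ₀ δ₁, lt_min hδ₀ hδ₁, fun q hq s hs => ?_⟩
      have e₀ := mul_le_mul_of_nonneg_left
        ((mul_le_mul_of_nonneg_right (min_le_left δ₀ δ₁) hs).trans (h₀ s hs)) (sub_nonneg.2 hq.2)
      have e₁ := mul_le_mul_of_nonneg_left
        ((mul_le_mul_of_nonneg_right (min_le_right δ₀ δ₁) hs).trans (h₁ s hs)) hq.1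
      linarith
  have hγw' : ∀ q ∈ Set.Icc (0 : ℝ) 1, γw q = sSup {s : ℝ | 0 ≤ s ∧
      (1 - q) * mgf (B' + -A) μ s + q * mgf (fun ω => c + (-A) ω) μ s ≤ 1} := by
    intro q hq
    rw [hγw q]
    congr 1
    ext s
    refine and_congr_right fun hs => ?_
    have hq' : 0 ≤ 1 - q := sub_nonneg.2 hq.2
    rw [emgf_eq_ofReal_mgf (hAexp s hs), emgf_eq_ofReal_mgf (hBexp s),
      ← ENNReal.ofReal_mul hq', ← ENNReal.ofReal_mul hq.1, ← ENNReal.ofReal_add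
        (mul_nonneg hq' mgf_nonneg) (mul_nonneg hq.1 (Real.exp_pos _).le),
      ← ENNReal.ofReal_mul mgf_nonneg, ENNReal.ofReal_le_one, hmgf₀, hmgf₁]
    ring_nf
  have hγwcont : ContinuousOn γw (Set.Icc 0 1) := hfam.continuousOn_root hγw'
  have hγw0 : ∀ q ∈ Set.Icc (0 : ℝ) 1, 0 ≤ γw q := fun q hq =>
    (hγw' q hq).symm ▸ hfam.root_nonneg hq
  have hΨ0 : ∀ q ∈ Set.Icc (0 : ℝ) 1, ∀ s, 0 ≤ s → 0 ≤ Ψ1 q s := fun q hq s hs =>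
    (hΨ1 q hq.1 hq.2 s hs).1
  have hBpos : ∀ q ∈ Set.Icc (0 : ℝ) 1, ∀ s, 0 < (1 - q) * mgf B' μ s + q := by
    intro q hq s
    rcases hq.1.eq_or_lt with rfl | h
    · simpa using mgf_pos (hBexp s)
    · exact add_pos_of_nonneg_of_pos (mul_nonneg (sub_nonneg.2 hq.2) mgf_nonneg) h
  have hΨeq : ∀ q ∈ Set.Icc (0 : ℝ) 1, ∀ s, 0 ≤ s →
      mgf A μ (-Ψ1 q s) * ((1 - q) * mgf B' μ s + q) = 1 := by
    intro q hq s hs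
    obtain ⟨h0, h1⟩ := hΨ1 q hq.1 hq.2 s hs
    have hq' : 0 ≤ 1 - q := sub_nonneg.2 hq.2
    rwa [emgf_eq_ofReal_mgf (hAexp _ h0), emgf_eq_ofReal_mgf (hBexp s),
      ← ENNReal.ofReal_mul hq', ← ENNReal.ofReal_add (mul_nonneg hq' mgf_nonneg) hq.1,
      ← ENNReal.ofReal_mul mgf_nonneg, ENNReal.ofReal_eq_one] at h1
  have hΨcont : ContinuousOn (fun p : ℝ × ℝ => Ψ1 p.1 p.2) (Set.Icc 0 1 ×ˢ Set.Ici 0) := by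
    have hmc : Continuous (mgf B' μ) := continuous_mgf hBexp
    refine continuousOn_of_strictAntiOn_mul_eq_one ha
      (g := fun p : ℝ × ℝ => (1 - p.1) * mgf B' μ p.2 + p.1) (by fun_prop)
      (fun p hp => hBpos p.1 hp.1 p.2) (fun p hp => hΨ0 p.1 hp.1 p.2 hp.2)
      fun p hp => hΨeq p.1 hp.1 p.2 hp.2
  have hcont : ContinuousOn γv (Set.Icc 0 1) :=
    (continuousOn_sSup_segment (h := fun q s => s - Ψ1 q s)
      (continuousOn_snd.sub hΨcont) hγwcont hγw0).congr fun q _ => hγv q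
  have h0I : (0 : ℝ) ∈ Set.Icc (0 : ℝ) 1 := Set.left_mem_Icc.2 zero_le_one
  have h1I : (1 : ℝ) ∈ Set.Icc (0 : ℝ) 1 := Set.right_mem_Icc.2 zero_le_one
  refine ⟨hcont, ?_, ?_, fun x hx => intermediate_value_Icc zero_le_one hcont hx⟩
  · have hΨ : ∀ s, 0 ≤ s → Ψ1 1 s = 0 := fun s hs => by
      refine ha.injOn (hΨ0 1 h1I s hs) (Set.mem_Ici.2 le_rfl) ?_
      simpa using hΨeq 1 h1I s hs
    rw [hγv 1]
    refine IsGreatest.csSup_eq ⟨⟨γw 1, hγw0 1 h1I, le_rfl, ?_⟩, ?_⟩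
    · rw [hΨ _ (hγw0 1 h1I), sub_zero]
    · rintro x ⟨s, hs, hsγ, rfl⟩
      rwa [hΨ s hs, sub_zero]
  · have hΨ00 : Ψ1 0 0 = 0 := by
      refine ha.injOn (hΨ0 0 h0I 0 le_rfl) (Set.mem_Ici.2 le_rfl) ?_
      simpa using hΨeq 0 h0I 0 le_rfl
    have hbdd : BddAbove {x : ℝ | ∃ s, 0 ≤ s ∧ s ≤ γw 0 ∧ x = s - Ψ1 0 s} := by
      refine ⟨γw 0, ?_⟩
      rintro x ⟨s, hs, hsγ, rfl⟩
      linarith [hΨ0 0 h0I s hs]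
    have hle : ∀ s, 0 ≤ s → s - Ψ1 0 s ≤ γv 0 := by
      intro s hs
      rw [hγv 0]
      rcases le_or_gt s (γw 0) with h | h
      · exact le_csSup hbdd ⟨s, hs, h, rfl⟩
      · have hzero := le_csSup hbdd ⟨0, le_rfl, hγw0 0 h0I, rfl⟩
        rw [hΨ00, sub_zero] at hzero
        rw [hγw' 0 h0I] at h
        have h1 := hfam.one_lt h0I h
        simp only [sub_zero, one_mul, zero_mul, add_zero, hmgf₀] at h1
        have h2 := hΨeq 0 h0I s hs
        simp only [sub_zero, one_mul, add_zero] at h2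
        rw [← h2] at h1
        have h3 := (ha.lt_iff_gt (hΨ0 0 h0I s hs) hs).1 (lt_of_mul_lt_mul_right h1 mgf_nonneg)
        linarith
    refine le_antisymm ?_ (csSup_le ⟨0 - Ψ1 0 0, 0, le_rfl, rfl⟩ ?_)
    · rw [hγv 0]
      refine csSup_le_csSup ⟨γv 0, ?_⟩ ⟨0 - Ψ1 0 0, 0, le_rfl, hγw0 0 h0I, rfl⟩ ?_
      · rintro x ⟨s, hs, rfl⟩
        exact hle s hs
      · rintro x ⟨s, hs, -, rfl⟩
        exact ⟨s, hs, rfl⟩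
    · rintro x ⟨s, hs, rfl⟩
      exact hle s hs
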